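/- arXiv:2408.07953 — 2 statements merged into one kernel-verified Lean document; each statement's English description precedes it below -/
import Mathlib

section
/- Let p be a prime and n ≥ 1. Let A and B be n×n matrices over ℚ_p with A upper unitriangular and B lower unitriangular. If every entry of the product A·B lies in ℤ_p, then every entry of A and every entry of B lies in ℤ_p. Equivalently, as subsets of GL_n(ℚ_p): GL_n(ℤ_p) ∩ N(ℚ_p)·N⁻(ℚ_p) = N(ℤ_p)·N⁻(ℤ_p). -/
/-- If `A` is upper unitriangular, `B` is lower unitriangular and the entries of `A * B` lie in a
subring `S`, then so do the entries of `A` and `B`. -/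
theorem Matrix.unitriangular_entries_mem_of_mul {ι R : Type*} [Fintype ι] [LinearOrder ι] [Ring R]
    (S : Subring R) (A B : Matrix ι ι R)
    (hAdiag : ∀ i, A i i = 1) (hAlow : ∀ i j, j < i → A i j = 0)
    (hBdiag : ∀ i, B i i = 1) (hBupp : ∀ i j, i < j → B i j = 0)
    (hAB : ∀ i j, (A * B) i j ∈ S) (k : ι) :
    (∀ i, A i k ∈ S) ∧ ∀ j, B k j ∈ S := by
  induction k using WellFoundedGT.induction with
  | ind k ih =>
    have key (i j : ι) (h : ∀ l < k, A i l * B l j = 0) : A i k * B k j ∈ S := by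
      have hsum : A i k * B k j + ∑ l ∈ Finset.univ.erase k, A i l * B l j ∈ S := by
        rw [Finset.add_sum_erase _ (fun l => A i l * B l j) (Finset.mem_univ k), ← Matrix.mul_apply]
        exact hAB i j
      refine (S.add_mem_cancel_right (S.sum_mem fun l hl => ?_)).1 hsum
      rcases (Finset.ne_of_mem_erase hl).lt_or_gt with hlk | hlk
      · rw [h l hlk]
        exact S.zero_mem
      · exact S.mul_mem ((ih l hlk).1 i) ((ih l hlk).2 j)
    refine ⟨fun i => ?_, fun j => ?_⟩
    · simpa [hBdiag] using key i k fun l hl => by rw [hBupp l k hl, mul_zero]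
    · simpa [hAdiag] using key k j fun l hl => by rw [hAlow k l hl, zero_mul]

/-- Let `p` be a prime and `n ≥ 1`. Let `A` and `B` be `n×n` matrices over
`ℚ_p` with `A` upper unitriangular and `B` lower unitriangular. If every entry of the product
`A·B` lies in `ℤ_p` (i.e. has norm `≤ 1`), then every entry of `A` and every entry of `B` lies
in `ℤ_p`. Equivalently, `GL_n(ℤ_p) ∩ N(ℚ_p)·N⁻(ℚ_p) = N(ℤ_p)·N⁻(ℤ_p)`. -/
theorem unitriangular_mul_integral (p : ℕ) [Fact p.Prime] (n : ℕ) (hn : 1 ≤ n)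
    (A B : Matrix (Fin n) (Fin n) ℚ_[p])
    (hAdiag : ∀ i, A i i = 1) (hAlow : ∀ i j : Fin n, j < i → A i j = 0)
    (hBdiag : ∀ i, B i i = 1) (hBupp : ∀ i j : Fin n, i < j → B i j = 0)
    (hAB : ∀ i j, ‖(A * B) i j‖ ≤ 1) :
    (∀ i j, ‖A i j‖ ≤ 1) ∧ (∀ i j, ‖B i j‖ ≤ 1) := by
  have h := Matrix.unitriangular_entries_mem_of_mul (PadicInt.subring p) A B
    hAdiag hAlow hBdiag hBupp hAB
  exact ⟨fun i j => (h j).1 i, fun i j => (h i).2 j⟩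
end

section
/- Let p be a prime, n ≥ 1, and λ = (λ_1,…,λ_n) ∈ ℤⁿ with λ_1 ≥ λ_2 ≥ ⋯ ≥ λ_n (a dominant cocharacter of GL_n). Let σ be a permutation of {1,…,n} and set σλ := (λ_{σ^{−1}(1)},…,λ_{σ^{−1}(n)}). Then, as subsets of GL_n(ℚ_p): N(ℚ_p) · d_{σλ} · GL_n(ℤ_p) ∩ GL_n(ℤ_p) · d_λ · GL_n(ℤ_p) = N(ℤ_p) · d_{σλ} · GL_n(ℤ_p). -/
open scoped Pointwise

/-- The set of upper unitriangular `n×n` matrices over `ℚ_p` (the group `N(ℚ_p)`). -/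
def Nqp (p : ℕ) [Fact p.Prime] (n : ℕ) : Set (Matrix (Fin n) (Fin n) ℚ_[p]) :=
  {A | (∀ i, A i i = 1) ∧ ∀ i j : Fin n, j < i → A i j = 0}

/-- The set of upper unitriangular `n×n` matrices with entries in `ℤ_p` (the group `N(ℤ_p)`). -/
def Nzp (p : ℕ) [Fact p.Prime] (n : ℕ) : Set (Matrix (Fin n) (Fin n) ℚ_[p]) :=
  {A | (∀ i, A i i = 1) ∧ (∀ i j : Fin n, j < i → A i j = 0) ∧ ∀ i j, ‖A i j‖ ≤ 1}

/-- The set `GL_n(ℤ_p)` of matrices with entries in `ℤ_p` invertible with integral inverse,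
viewed inside the matrices over `ℚ_p`. -/
def GLzp (p : ℕ) [Fact p.Prime] (n : ℕ) : Set (Matrix (Fin n) (Fin n) ℚ_[p]) :=
  {A | (∀ i j, ‖A i j‖ ≤ 1) ∧ ∃ B : Matrix (Fin n) (Fin n) ℚ_[p],
    (∀ i j, ‖B i j‖ ≤ 1) ∧ A * B = 1 ∧ B * A = 1}

/-- The diagonal matrix `d_μ = diag(p^{μ_1},…,p^{μ_n}) ∈ GL_n(ℚ_p)` attached to a cocharacter
`μ ∈ ℤⁿ`. -/
noncomputable def dMat (p : ℕ) [Fact p.Prime] (n : ℕ) (μ : Fin n → ℤ) : Matrix (Fin n) (Fin n) ℚ_[p] :=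
  Matrix.diagonal fun i => (p : ℚ_[p]) ^ (μ i)

/-- In a valuation ring, a nonempty finite family has a member dividing all the others. -/
theorem ValuationRing.exists_dvd_of_finset {R ι : Type*} [CommRing R] [IsDomain R]
    [ValuationRing R] (f : ι → R) {s : Finset ι} (hs : s.Nonempty) :
    ∃ a ∈ s, ∀ b ∈ s, f a ∣ f b := by
  induction hs using Finset.Nonempty.cons_induction with
  | singleton a => exact ⟨a, by simp⟩
  | cons a s ha hs ih =>
    obtain ⟨c, hc, h⟩ := ih
    rcases ValuationRing.dvd_total (f a) (f c) with hac | hca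
    · refine ⟨a, by simp, fun b hb => ?_⟩
      rcases Finset.mem_cons.1 hb with rfl | hb
      exacts [dvd_rfl, hac.trans (h b hb)]
    · refine ⟨c, by simp [hc], fun b hb => ?_⟩
      rcases Finset.mem_cons.1 hb with rfl | hb
      exacts [hca, h b hb]

/-- Column reduction: over a valuation ring, every square matrix becomes upper triangular after
multiplication on the right by an invertible matrix. -/
theorem Matrix.exists_unit_mul_upperTriangular {R : Type*} [CommRing R] [IsDomain R]
    [ValuationRing R] {n : ℕ} (M : Matrix (Fin n) (Fin n) R) :
    ∃ K : (Matrix (Fin n) (Fin n) R)ˣ, ∀ i j : Fin n, j < i → (M * K.1) i j = 0 := by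
  suffices h : ∀ r ≤ n, ∃ K : (Matrix (Fin n) (Fin n) R)ˣ,
      ∀ i j : Fin n, n ≤ i + r → j < i → (M * K.1) i j = 0 by
    obtain ⟨K, hK⟩ := h n le_rfl
    exact ⟨K, fun i j => hK i j (by omega)⟩
  intro r
  induction r with
  | zero => exact fun _ => ⟨1, fun i j h => by omega⟩
  | succ r ih =>
    intro hr
    obtain ⟨K, hK⟩ := ih (by omega)
    let i₀ : Fin n := ⟨n - (r + 1), by omega⟩
    obtain ⟨j₀, hj₀, hdvd⟩ := ValuationRing.exists_dvd_of_finset (fun j => (M * K.1) i₀ j)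
      (s := Finset.Iic i₀) ⟨i₀, by simp⟩
    rw [Finset.mem_Iic] at hj₀
    let τ := Equiv.swap j₀ i₀
    have hτ : ∀ j, j ≤ i₀ → τ j ≤ i₀ := by
      intro j hj
      simp only [τ, Equiv.swap_apply_def]
      split_ifs <;> simp_all
    let P : (Matrix (Fin n) (Fin n) R)ˣ :=
      ⟨τ.permMatrix R, τ⁻¹.permMatrix R, by
        rw [← Matrix.permMatrix_mul]; simp [τ], by
        rw [← Matrix.permMatrix_mul]; simp [τ]⟩
    have hP : ∀ i j, (M * K.1 * P.1) i j = (M * K.1) i (τ j) := by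
      intro i j
      simp [P, PEquiv.mul_toMatrix_toPEquiv, τ]
    have hq : ∀ j, ∃ c, j < i₀ → (M * K.1 * P.1) i₀ j = (M * K.1 * P.1) i₀ i₀ * c := by
      intro j
      by_cases hj : j < i₀
      · obtain ⟨c, hc⟩ := hdvd (τ j) (by simpa using hτ j hj.le)
        exact ⟨c, fun _ => by rw [hP, hP, hc]; simp [τ]⟩
      · exact ⟨0, fun h => absurd h hj⟩
    choose c hc using hq
    let v : Fin n → R := fun j => if j < i₀ then c j else 0
    have hv : v i₀ = 0 := by simp [v]
    let N : Matrix (Fin n) (Fin n) R := Matrix.vecMulVec (Pi.single i₀ 1) v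
    have hN : N * N = 0 := by
      simp [N, Matrix.vecMulVec_mul_vecMulVec, hv]
    let E : (Matrix (Fin n) (Fin n) R)ˣ :=
      ⟨1 - N, 1 + N, by noncomm_ring; simp [hN], by noncomm_ring; simp [hN]⟩
    have hE : ∀ i j, (M * K.1 * P.1 * E.1) i j =
        (M * K.1 * P.1) i j - (M * K.1 * P.1) i i₀ * v j := by
      intro i j
      simp [E, N, Matrix.mul_sub, Matrix.mul_vecMulVec, Matrix.vecMulVec_apply]
    refine ⟨K * P * E, fun i j hi hj => ?_⟩
    simp only [Units.val_mul, ← Matrix.mul_assoc]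
    rw [hE]
    rcases eq_or_ne i i₀ with rfl | hne
    · simp [v, hj, hc j hj]
    · have hi' : n ≤ i + r := by
        have : (i : ℕ) ≠ n - (r + 1) := fun h => hne (Fin.ext h)
        omega
      have hlt : i₀ < i := by
        simp only [Fin.lt_def, i₀]; omega
      have h₁ : (M * K.1 * P.1) i i₀ = 0 := by
        rw [hP]; exact hK i _ hi' ((hτ _ le_rfl).trans_lt hlt)
      rw [h₁, zero_mul, sub_zero, hP]
      rcases le_or_gt j i₀ with hji | hji
      · exact hK i _ hi' ((hτ _ hji).trans_lt hlt)
      · rw [show τ j = j from Equiv.swap_apply_of_ne_of_ne (hj₀.trans_lt hji).ne' hji.ne']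
        exact hK i j hi' hj

/-- Base change of matrices from `ℤ_p` to `ℚ_p`. -/
noncomputable def toQp (p : ℕ) [Fact p.Prime] (n : ℕ) :
    Matrix (Fin n) (Fin n) ℤ_[p] →+* Matrix (Fin n) (Fin n) ℚ_[p] :=
  (PadicInt.Coe.ringHom (p := p)).mapMatrix

section

variable {p : ℕ} [Fact p.Prime] {n : ℕ}

theorem toQp_apply (X : Matrix (Fin n) (Fin n) ℤ_[p]) (i j : Fin n) :
    toQp p n X i j = (X i j : ℚ_[p]) := rfl

theorem exists_toQp_eq {A : Matrix (Fin n) (Fin n) ℚ_[p]} (hA : ∀ i j, ‖A i j‖ ≤ 1) :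
    ∃ X, toQp p n X = A :=
  ⟨Matrix.of fun i j => ⟨A i j, hA i j⟩, rfl⟩

theorem toQp_injective : Function.Injective (toQp p n) := fun X Y h => by
  ext i j : 2
  exact PadicInt.ext (congrFun₂ h i j)

theorem mem_GLzp_iff {A : Matrix (Fin n) (Fin n) ℚ_[p]} :
    A ∈ GLzp p n ↔ ∃ U : (Matrix (Fin n) (Fin n) ℤ_[p])ˣ, toQp p n U = A := by
  constructor
  · rintro ⟨hA, B, hB, hAB, hBA⟩
    obtain ⟨X, rfl⟩ := exists_toQp_eq hA
    obtain ⟨Y, rfl⟩ := exists_toQp_eq hB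
    refine ⟨⟨X, Y, toQp_injective ?_, toQp_injective ?_⟩, rfl⟩ <;> simpa
  · rintro ⟨U, rfl⟩
    refine ⟨fun i j => (U.1 i j).2, toQp p n U⁻¹.1, fun i j => (U⁻¹.1 i j).2, ?_, ?_⟩ <;>
      simp [← map_mul]

theorem dMat_mul_toQp_diagonal (μ : Fin n → ℤ) (e : Fin n → ℕ) :
    dMat p n μ * toQp p n (Matrix.diagonal fun i => (p : ℤ_[p]) ^ e i) =
      dMat p n fun i => μ i + e i := by
  have hp : (p : ℚ_[p]) ≠ 0 := by exact_mod_cast (Fact.out : p.Prime).ne_zero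
  have : toQp p n (Matrix.diagonal fun i => (p : ℤ_[p]) ^ e i) =
      Matrix.diagonal fun i => (p : ℚ_[p]) ^ e i := by
    ext i j
    rw [toQp_apply, Matrix.diagonal_apply, Matrix.diagonal_apply]
    split_ifs <;> simp
  rw [this, dMat, dMat, Matrix.diagonal_mul_diagonal]
  simp [zpow_add₀ hp]

theorem dMat_const (c : ℤ) : dMat p n (fun _ => c) = (p : ℚ_[p]) ^ c • 1 := by
  rw [dMat, Matrix.smul_one_eq_diagonal]

theorem norm_det_unit (U : (Matrix (Fin n) (Fin n) ℤ_[p])ˣ) : ‖U.1.det‖ = 1 :=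
  PadicInt.isUnit_iff.1 ((Matrix.isUnit_iff_isUnit_det _).1 U.isUnit)

theorem dMat_comp_symm (lam : Fin n → ℤ) (σ : Equiv.Perm (Fin n)) :
    ∃ P : (Matrix (Fin n) (Fin n) ℤ_[p])ˣ,
      dMat p n (lam ∘ σ.symm) = toQp p n P * dMat p n lam * toQp p n P⁻¹.1 := by
  let P : (Matrix (Fin n) (Fin n) ℤ_[p])ˣ :=
    ⟨σ⁻¹.permMatrix _, σ.permMatrix _, by
      rw [← Matrix.permMatrix_mul]; simp, by
      rw [← Matrix.permMatrix_mul]; simp⟩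
  have h : ∀ τ : Equiv.Perm (Fin n), toQp p n (τ.permMatrix _) = τ.permMatrix _ := by
    intro τ
    ext i j
    rw [toQp_apply]
    simp only [Equiv.Perm.permMatrix, PEquiv.toMatrix_apply]
    split_ifs <;> simp
  refine ⟨P, ?_⟩
  change _ = toQp p n (σ⁻¹.permMatrix _) * _ * toQp p n (σ.permMatrix _)
  rw [h, h, PEquiv.toMatrix_toPEquiv_mul, PEquiv.mul_toMatrix_toPEquiv]
  ext i j
  simp [dMat, Matrix.diagonal_apply]

/-- If the triangular matrix `u d_μ` has Smith form `d_λ`, where `μ` is a rearrangement of `λ`,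
then the lattice it spans contains a vector divisible by `p^{μ_i}` whose last nonzero coordinate is
`p^{μ_i}`, in position `i`. -/
theorem exists_integral_column {lam μ : Fin n → ℤ} {σ : Equiv.Perm (Fin n)}
    (hμ : μ = lam ∘ σ.symm) {u : Matrix (Fin n) (Fin n) ℚ_[p]} (hu : u ∈ Nqp p n)
    (K₁ K₂ : (Matrix (Fin n) (Fin n) ℤ_[p])ˣ)
    (h : u * dMat p n μ = toQp p n K₁ * dMat p n lam * toQp p n K₂) (i : Fin n) :
    ∃ x : Fin n → ℤ_[p], x i = 1 ∧ (∀ j, i < j → x j = 0) ∧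
      ∀ k, ∃ y : ℤ_[p],
        ((u * dMat p n μ).mulVec fun j => (x j : ℚ_[p])) k = y * (p : ℚ_[p]) ^ μ i := by
  have hp : (p : ℚ_[p]) ≠ 0 := by exact_mod_cast (Fact.out : p.Prime).ne_zero
  set c := μ i with hc
  set A := u * dMat p n μ with hA
  let e : Fin n → ℕ := fun j => (c - lam j).toNat
  let f : Fin n → ℕ := fun j => (lam j - c).toNat
  let D (e : Fin n → ℕ) : Matrix (Fin n) (Fin n) ℤ_[p] :=
    Matrix.diagonal fun i => (p : ℤ_[p]) ^ e i
  obtain ⟨K, hK⟩ := Matrix.exists_unit_mul_upperTriangular (K₂⁻¹.1 * D e)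
  set X := K₂⁻¹.1 * D e * K.1 with hX
  have hAX : A * toQp p n X = (p : ℚ_[p]) ^ c • toQp p n (K₁.1 * D f * K.1) := by
    have h₂ : toQp p n K₂.1 * toQp p n K₂⁻¹.1 = 1 := by simp [← map_mul]
    have hD : dMat p n lam * toQp p n (D e) = (p : ℚ_[p]) ^ c • toQp p n (D f) := by
      have : (p : ℚ_[p]) ^ c • toQp p n (D f) = dMat p n (fun _ => c) * toQp p n (D f) := by
        rw [dMat_const, Matrix.smul_mul, one_mul]
      rw [this, dMat_mul_toQp_diagonal, dMat_mul_toQp_diagonal]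
      congr 1
      ext j
      simp only [e, f]
      omega
    calc A * toQp p n X
        = toQp p n K₁ * (dMat p n lam * ((toQp p n K₂.1 * toQp p n K₂⁻¹.1) * toQp p n (D e)))
            * toQp p n K := by simp only [h, hX, map_mul, Matrix.mul_assoc]
      _ = _ := by
        rw [h₂, one_mul, hD]
        simp only [map_mul, Matrix.mul_smul, Matrix.smul_mul]
  have hdiag : ∀ j, (A * toQp p n X) j j = (p : ℚ_[p]) ^ μ j * X j j := by
    intro j
    rw [Matrix.mul_apply, Finset.sum_eq_single j]
    · simp [hA, dMat, toQp_apply, hu.1]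
    · intro k _ hk
      rcases lt_or_gt_of_ne hk with hk | hk
      · simp [hA, dMat, hu.2 j k hk]
      · simp [toQp_apply, hK k j hk]
    · simp
  have hle : ∀ j, ‖X j j‖ ≤ (p : ℝ) ^ (-((c - μ j).toNat : ℤ)) := by
    intro j
    rcases le_or_gt c (μ j) with hj | hj
    · rw [Int.toNat_of_nonpos (by omega)]
      simpa using PadicInt.norm_le_one (X j j)
    · have h₁ := hdiag j
      rw [hAX, Matrix.smul_apply, toQp_apply, smul_eq_mul] at h₁
      have h₂ : (X j j : ℚ_[p]) =
          (p : ℚ_[p]) ^ (c - μ j) * ((K₁.1 * D f * K.1) j j : ℤ_[p]) := by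
        rw [zpow_sub₀ hp]
        field_simp
        rw [h₁]; ring
      rw [PadicInt.norm_def, h₂, norm_mul, Padic.norm_p_zpow, Int.toNat_of_nonneg (by omega)]
      exact mul_le_of_le_one_right (by positivity) (PadicInt.norm_le_one _)
  have hdet : ∏ j, ‖X j j‖ = ∏ j, (p : ℝ) ^ (-((c - μ j).toNat : ℤ)) := by
    have h₁ : X.det = ∏ j, X j j := Matrix.det_of_isUpperTriangular fun i j hij => hK i j hij
    rw [← norm_prod, ← h₁, hX, Matrix.det_mul, Matrix.det_mul, norm_mul, norm_mul, norm_det_unit,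
      norm_det_unit, Matrix.det_diagonal, norm_prod, one_mul, mul_one, hμ,
      ← Equiv.prod_comp σ.symm]
    simp only [PadicInt.norm_p_pow, e, Function.comp_apply]
  have hXi : ‖X i i‖ = 1 := by
    by_contra hne
    have hlt : ‖X i i‖ < 1 := lt_of_le_of_ne (PadicInt.norm_le_one _) hne
    have hpos : ∀ j, 0 < ‖X j j‖ := by
      intro j
      refine lt_of_le_of_ne (norm_nonneg _) fun h₀ => ?_
      have : ∏ j, ‖X j j‖ = 0 := Finset.prod_eq_zero (Finset.mem_univ j) h₀.symm
      rw [hdet] at this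
      exact (Finset.prod_pos fun j _ => zpow_pos (Nat.cast_pos.2 (Fact.out : p.Prime).pos) _).ne' this
    exact (Finset.prod_lt_prod (fun j _ => hpos j) (fun j _ => hle j)
      ⟨i, Finset.mem_univ i, by simpa [hc] using hlt⟩).ne hdet
  obtain ⟨w, hw⟩ := PadicInt.isUnit_iff.2 hXi
  refine ⟨fun j => X j i * w⁻¹.1, by simp [← hw], fun j hj => by simp [hK j i hj], fun k => ?_⟩
  refine ⟨(K₁.1 * D f * K.1) k i * w⁻¹.1, ?_⟩
  have h₁ := congrFun₂ hAX k i
  rw [Matrix.smul_apply, toQp_apply, smul_eq_mul, Matrix.mul_apply] at h₁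
  simp only [Matrix.mulVec, dotProduct, PadicInt.coe_mul, ← mul_assoc, ← Finset.sum_mul]
  simp only [toQp_apply] at h₁
  rw [h₁]
  ring

end

/-- Let `p` be a prime, `n ≥ 1`, and `λ ∈ ℤⁿ` with `λ_1 ≥ ⋯ ≥ λ_n` (a dominant
cocharacter of `GL_n`). Let `σ` be a permutation of `{1,…,n}` and `σλ := (λ_{σ⁻¹(1)},…,λ_{σ⁻¹(n)})`.
Then, as subsets of `GL_n(ℚ_p)`:
`N(ℚ_p)·d_{σλ}·GL_n(ℤ_p) ∩ GL_n(ℤ_p)·d_λ·GL_n(ℤ_p) = N(ℤ_p)·d_{σλ}·GL_n(ℤ_p)`. -/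
theorem semiinfinite_orbit_cap_schubert_cell (p : ℕ) [Fact p.Prime] (n : ℕ) (hn : 1 ≤ n)
    (lam : Fin n → ℤ) (hlam : ∀ i j : Fin n, i ≤ j → lam j ≤ lam i)
    (σ : Equiv.Perm (Fin n)) :
    (Nqp p n * {dMat p n (lam ∘ σ.symm)} * GLzp p n) ∩
        (GLzp p n * {dMat p n lam} * GLzp p n) =
      Nzp p n * {dMat p n (lam ∘ σ.symm)} * GLzp p n := by
  apply Set.Subset.antisymm
  · rintro _ ⟨⟨_, ⟨u, hu, _, rfl, rfl⟩, k, hk, rfl⟩, ⟨_, ⟨k₁, hk₁, _, rfl, rfl⟩, k₃, hk₃, h⟩⟩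
    obtain ⟨K, rfl⟩ := mem_GLzp_iff.1 hk
    obtain ⟨K₁, rfl⟩ := mem_GLzp_iff.1 hk₁
    obtain ⟨K₃, rfl⟩ := mem_GLzp_iff.1 hk₃
    set μ := lam ∘ σ.symm with hμ
    have hp : (p : ℚ_[p]) ≠ 0 := by exact_mod_cast (Fact.out : p.Prime).ne_zero
    have h' : u * dMat p n μ = toQp p n K₁ * dMat p n lam * toQp p n (K₃ * K⁻¹).1 := by
      have hKK : toQp p n K.1 * toQp p n K⁻¹.1 = 1 := by simp [← map_mul]
      dsimp only at h
      rw [Units.val_mul, map_mul, ← Matrix.mul_assoc, h, Matrix.mul_assoc _ (toQp p n K.1), hKK,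
        mul_one]
    choose x hx₁ hx₀ y hy using exists_integral_column hμ hu K₁ (K₃ * K⁻¹) h'
    let X : Matrix (Fin n) (Fin n) ℤ_[p] := Matrix.of fun j i => x i j
    have hX : IsUnit X := by
      rw [Matrix.isUnit_iff_isUnit_det, Matrix.det_of_isUpperTriangular (M := X) fun j i hij => hx₀ i j hij]
      simp [X, hx₁]
    obtain ⟨U, hU⟩ := hX
    let V : Matrix (Fin n) (Fin n) ℤ_[p] := Matrix.of fun k i => y i k
    have hV : u * dMat p n μ * toQp p n X = toQp p n V * dMat p n μ := by
      ext k i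
      rw [dMat, Matrix.mul_diagonal]
      exact hy i k
    have hVe : ∀ k i, toQp p n V k i =
        (u * dMat p n μ * toQp p n X) k i * ((p : ℚ_[p]) ^ μ i)⁻¹ := by
      intro k i
      have hpi : (p : ℚ_[p]) ^ μ i ≠ 0 := zpow_ne_zero _ hp
      rw [hV, dMat, Matrix.mul_diagonal, mul_inv_cancel_right₀ hpi]
    refine ⟨_, ⟨toQp p n V, ⟨fun i => ?_, fun i j hij => ?_, fun i j => (V i j).2⟩, _, rfl, rfl⟩,
      toQp p n (U⁻¹ * K).1, mem_GLzp_iff.2 ⟨_, rfl⟩, ?_⟩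
    · rw [hVe, Matrix.mul_apply, Finset.sum_eq_single i]
      · simp [dMat, toQp_apply, hu.1, X, hx₁, mul_inv_cancel₀ (zpow_ne_zero (μ i) hp)]
      · intro k _ hk
        rcases lt_or_gt_of_ne hk with hk | hk
        · simp [dMat, hu.2 i k hk]
        · simp [toQp_apply, X, hx₀ i k hk]
      · simp
    · rw [hVe, Matrix.mul_apply, Finset.sum_eq_zero, zero_mul]
      intro k _
      rcases lt_or_ge k i with hk | hk
      · simp [dMat, hu.2 i k hk]
      · simp [toQp_apply, X, hx₀ j k (hij.trans_le hk)]
    · have hUU : toQp p n U.1 * toQp p n U⁻¹.1 = 1 := by simp [← map_mul]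
      dsimp only
      rw [← hV, ← hU, Units.val_mul, map_mul, ← Matrix.mul_assoc, Matrix.mul_assoc _ (toQp p n U.1),
        hUU, mul_one]
  · rintro _ ⟨_, ⟨u, ⟨hu₁, hu₀, hui⟩, _, rfl, rfl⟩, k, hk, rfl⟩
    refine ⟨⟨_, ⟨u, ⟨hu₁, hu₀⟩, _, rfl, rfl⟩, k, hk, rfl⟩, ?_⟩
    obtain ⟨K, rfl⟩ := mem_GLzp_iff.1 hk
    obtain ⟨V, rfl⟩ := exists_toQp_eq hui
    have hV : IsUnit V := by
      rw [Matrix.isUnit_iff_isUnit_det, Matrix.det_of_isUpperTriangular fun i j hij =>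
        PadicInt.ext (hu₀ i j hij)]
      simp [show ∀ i, V i i = 1 from fun i => PadicInt.ext (hu₁ i)]
    obtain ⟨U, rfl⟩ := hV
    obtain ⟨P, hP⟩ := dMat_comp_symm (p := p) lam σ
    refine ⟨_, ⟨toQp p n (U * P).1, mem_GLzp_iff.2 ⟨_, rfl⟩, _, rfl, rfl⟩,
      toQp p n (P⁻¹ * K).1, mem_GLzp_iff.2 ⟨_, rfl⟩, ?_⟩
    simp only [hP, Units.val_mul, map_mul, Matrix.mul_assoc]
end
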